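/- arXiv:0809.4579 — 2 statements merged into one kernel-verified Lean document; each statement's English description precedes it below -/
import Mathlib

section
/- Let p be a prime, q = p^m, and let K be a field of characteristic p containing F_q. Fix t ∈ K^* and define in PGL(2,K): ε_u = class of [[1,u],[0,1]] for u ∈ F_q, τ = class of [[0,t],[1,0]], ε'_u = τ ε_u τ, μ_a = class of [[a,0],[0,1]] for a ∈ F_q^*, δ_{u,v} = ε_u ε'_v ε_u^{−1} ε'_v^{−1}, and let Γ be the subgroup of PGL(2,K) generated by {δ_{u,v} : u,v ∈ F_q}, and N the subgroup of PGL(2,K) generated by {ε_u : u ∈ F_q} ∪ {τ} ∪ {μ_a : a ∈ F_q^*}. Then Γ ⊆ N and Γ is a normal subgroup of N: for every g ∈ N, gΓg^{−1} = Γ. -/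
open scoped Classical

/-- The projective general linear group `PGL(2,K)`: the quotient of `GL(2,K)` by its center
(the nonzero scalar matrices). -/
abbrev PGL2 (K : Type*) [Field K] :=
  Matrix.GeneralLinearGroup (Fin 2) K ⧸
    Subgroup.center (Matrix.GeneralLinearGroup (Fin 2) K)

/-- The class in `PGL(2,K)` of a 2×2 matrix with nonzero determinant. -/
noncomputable def pgl2 {K : Type*} [Field K] (A : Matrix (Fin 2) (Fin 2) K)
    (h : A.det ≠ 0) : PGL2 K :=
  QuotientGroup.mk (Matrix.GeneralLinearGroup.mkOfDetNeZero A h)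

/-- `ε_c`: the class in `PGL(2,K)` of the matrix `[[1, c], [0, 1]]`. -/
noncomputable def eps {K : Type*} [Field K] (c : K) : PGL2 K :=
  pgl2 !![1, c; 0, 1] (by simp [Matrix.det_fin_two_of])

/-- `τ_t`: the class in `PGL(2,K)` of the matrix `[[0, t], [1, 0]]` (junk value `1` when
`t = 0`). -/
noncomputable def tau {K : Type*} [Field K] (t : K) : PGL2 K :=
  if h : t = 0 then 1 else pgl2 !![0, t; 1, 0] (by simp [Matrix.det_fin_two_of, h])

/-- `ε'_{c,t} = τ_t ε_c τ_t`: the class in `PGL(2,K)` of the matrix `[[t, 0], [c, t]]`. -/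
noncomputable def eps' {K : Type*} [Field K] (c t : K) : PGL2 K :=
  tau t * eps c * tau t

/-- `δ_{u,v,t}`: the commutator of `ε_u` and `ε'_{v,t}` in `PGL(2,K)`. -/
noncomputable def deltaC {K : Type*} [Field K] (u v t : K) : PGL2 K :=
  eps u * eps' v t * (eps u)⁻¹ * (eps' v t)⁻¹

/-- `μ_a`: the class in `PGL(2,K)` of the matrix `[[a, 0], [0, 1]]` (junk value `1` when
`a = 0`). -/
noncomputable def muA {K : Type*} [Field K] (a : K) : PGL2 K :=
  if h : a = 0 then 1 else pgl2 !![a, 0; 0, 1] (by simp [Matrix.det_fin_two_of, h])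

/-- `Γ(t)`: the subgroup of `PGL(2,K)` generated by the commutators `δ_{u,v,t}` for
`u, v ∈ F_q` (embedded in `K` via `i`); the Schottky group of the
Artin–Schreier–Mumford curve. -/
noncomputable def GammaASM {K : Type*} [Field K] {F : Type*} [Field F] [Fintype F]
    (i : F →+* K) (t : K) : Subgroup (PGL2 K) :=
  Subgroup.closure {g | ∃ u v : F, g = deltaC (i u) (i v) t}

/-- `N₁(t)`: the subgroup of `PGL(2,K)` generated by all `ε_u` and `ε'_{v,t}` for
`u, v ∈ F_q`. -/
noncomputable def N1ASM {K : Type*} [Field K] {F : Type*} [Field F] [Fintype F]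
    (i : F →+* K) (t : K) : Subgroup (PGL2 K) :=
  Subgroup.closure ({g | ∃ u : F, g = eps (i u)} ∪ {g | ∃ v : F, g = eps' (i v) t})

/-- `N₀(t)`: the subgroup of `PGL(2,K)` generated by `Γ(t)` together with the `ε'_{u,t}`. -/
noncomputable def N0ASM {K : Type*} [Field K] {F : Type*} [Field F] [Fintype F]
    (i : F →+* K) (t : K) : Subgroup (PGL2 K) :=
  GammaASM i t ⊔ Subgroup.closure {g | ∃ u : F, g = eps' (i u) t}

/-- `N(t)`: the subgroup of `PGL(2,K)` generated by the `ε_u`, `τ_t` and the `μ_a` for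
`a ∈ F_q^*`; the normalizer of the Schottky group `Γ(t)`. -/
noncomputable def NASM {K : Type*} [Field K] {F : Type*} [Field F] [Fintype F]
    (i : F →+* K) (t : K) : Subgroup (PGL2 K) :=
  Subgroup.closure
    ({g | ∃ u : F, g = eps (i u)} ∪ {tau t} ∪ {g | ∃ a : F, a ≠ 0 ∧ g = muA (i a)})

theorem pgl2_mul {K : Type*} [Field K] (A B : Matrix (Fin 2) (Fin 2) K)
    (hA : A.det ≠ 0) (hB : B.det ≠ 0) :
    pgl2 A hA * pgl2 B hB = pgl2 (A * B) (by rw [Matrix.det_mul]; exact mul_ne_zero hA hB) := by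
  unfold pgl2
  rw [← QuotientGroup.mk_mul]
  congr 1
  apply Units.ext
  rfl

theorem pgl2_eq {K : Type*} [Field K] (A B : Matrix (Fin 2) (Fin 2) K)
    (hA : A.det ≠ 0) (hB : B.det ≠ 0) (c : K) (h : B = c • A) :
    pgl2 A hA = pgl2 B hB := by
  unfold pgl2
  rw [QuotientGroup.eq, Subgroup.mem_center_iff]
  have key : ((Matrix.GeneralLinearGroup.mkOfDetNeZero A hA)⁻¹ *
      Matrix.GeneralLinearGroup.mkOfDetNeZero B hB).val = c • (1 : Matrix (Fin 2) (Fin 2) K) := by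
    have h1 : (Matrix.GeneralLinearGroup.mkOfDetNeZero B hB).val =
        c • (Matrix.GeneralLinearGroup.mkOfDetNeZero A hA).val := h
    rw [Units.val_mul, h1, Matrix.mul_smul, Units.inv_mul]
  intro g
  apply Units.ext
  rw [Units.val_mul g, Units.val_mul _ g, key]
  simp

theorem pgl2_eq_one {K : Type*} [Field K] (A : Matrix (Fin 2) (Fin 2) K)
    (hA : A.det ≠ 0) (c : K) (h : A = c • (1 : Matrix (Fin 2) (Fin 2) K)) :
    pgl2 A hA = 1 := by
  have h1 : pgl2 (1 : Matrix (Fin 2) (Fin 2) K) (by simp) = 1 := by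
    unfold pgl2
    rw [← QuotientGroup.mk_one]
    congr 1
    apply Units.ext
    rfl
  rw [← h1]
  exact (pgl2_eq _ _ _ _ c h).symm

theorem eps_add {K : Type*} [Field K] (a b : K) : eps (a + b) = eps a * eps b := by
  unfold eps
  rw [pgl2_mul]
  apply pgl2_eq _ _ _ _ 1
  simp [Matrix.mul_fin_two, add_comm]

theorem tau_mul_self {K : Type*} [Field K] (t : K) (ht : t ≠ 0) : tau t * tau t = 1 := by
  unfold tau
  rw [dif_neg ht, pgl2_mul]
  apply pgl2_eq_one _ _ t
  simp [Matrix.mul_fin_two, Matrix.one_fin_two]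

theorem mu_eps {K : Type*} [Field K] (a u : K) (ha : a ≠ 0) :
    muA a * eps u = eps (a * u) * muA a := by
  unfold muA eps
  rw [dif_neg ha, pgl2_mul, pgl2_mul]
  apply pgl2_eq _ _ _ _ 1
  simp [Matrix.mul_fin_two]

theorem mu_tau {K : Type*} [Field K] (a t : K) (ha : a ≠ 0) (ht : t ≠ 0) :
    muA a * tau t * muA a = tau t := by
  unfold muA tau
  rw [dif_neg ha, dif_neg ht, pgl2_mul, pgl2_mul]
  apply pgl2_eq _ _ _ _ a⁻¹
  simp [Matrix.mul_fin_two, ha]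

theorem mu_eps' {K : Type*} [Field K] (a v t : K) (ha : a ≠ 0) (ht : t ≠ 0) :
    muA a * eps' v t * (muA a)⁻¹ = eps' (a⁻¹ * v) t := by
  have h1 : muA a * tau t = tau t * (muA a)⁻¹ := eq_mul_inv_of_mul_eq (mu_tau a t ha ht)
  have h2 : tau t * (muA a)⁻¹ = muA a * tau t := h1.symm
  have h3 : eps v * muA a = muA a * eps (a⁻¹ * v) := by
    rw [mu_eps _ _ ha, mul_inv_cancel_left₀ ha]
  unfold eps'
  calc muA a * (tau t * eps v * tau t) * (muA a)⁻¹
      = (muA a * tau t) * eps v * (tau t * (muA a)⁻¹) := by group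
    _ = tau t * (muA a)⁻¹ * (eps v * muA a) * tau t := by rw [h2]; simp only [mul_assoc]
    _ = _ := by rw [h3]; group

theorem conj_eps {K : Type*} [Field K] (w u v t : K) :
    eps w * deltaC u v t * (eps w)⁻¹ = deltaC (w + u) v t * (deltaC w v t)⁻¹ := by
  unfold deltaC
  rw [eps_add]
  group

theorem conj_tau {K : Type*} [Field K] (u v t : K) (ht : t ≠ 0) :
    tau t * deltaC u v t * (tau t)⁻¹ = (deltaC v u t)⁻¹ := by
  have h : (tau t)⁻¹ = tau t := inv_eq_of_mul_eq_one_left (tau_mul_self t ht)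
  have h2 := tau_mul_self t ht
  have h3 : ∀ x, tau t * (tau t * x) = x := fun x => by rw [← mul_assoc, h2, one_mul]
  unfold deltaC eps'
  simp only [mul_inv_rev, inv_inv, h, mul_assoc, h2, h3, mul_one]

theorem conj_mu {K : Type*} [Field K] (a u v t : K) (ha : a ≠ 0) (ht : t ≠ 0) :
    muA a * deltaC u v t * (muA a)⁻¹ = deltaC (a * u) (a⁻¹ * v) t := by
  have h1 : muA a * eps u * (muA a)⁻¹ = eps (a * u) := by
    rw [mu_eps _ _ ha]; group
  unfold deltaC
  rw [← h1, ← mu_eps' a v t ha ht]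
  group

theorem delta_mem {K : Type*} [Field K] {F : Type*} [Field F] [Fintype F]
    (i : F →+* K) (t : K) (u v : F) : deltaC (i u) (i v) t ∈ GammaASM i t :=
  Subgroup.subset_closure ⟨u, v, rfl⟩

theorem conj_closed {G : Type*} [Group G] (S : Set G) (g : G)
    (h : ∀ x ∈ S, g * x * g⁻¹ ∈ Subgroup.closure S) :
    ∀ x ∈ Subgroup.closure S, g * x * g⁻¹ ∈ Subgroup.closure S := by
  have : Subgroup.closure S ≤ (Subgroup.closure S).comap (MulAut.conj g).toMonoidHom := by
    rw [Subgroup.closure_le]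
    intro x hx
    simpa using h x hx
  intro x hx
  simpa using this hx

theorem conj_N {K : Type*} [Field K] {F : Type*} [Field F] [Fintype F]
    (i : F →+* K) (t : K) (ht : t ≠ 0) (g : PGL2 K)
    (hg : g ∈ ({g | ∃ u : F, g = eps (i u)} ∪ {tau t} ∪
      {g | ∃ a : F, a ≠ 0 ∧ g = muA (i a)} : Set (PGL2 K))) :
    ∀ x ∈ GammaASM i t, g * x * g⁻¹ ∈ GammaASM i t := by
  apply conj_closed
  rintro x ⟨u, v, rfl⟩
  change _ ∈ GammaASM i t
  rcases hg with (⟨w, rfl⟩ | rfl) | ⟨a, ha, rfl⟩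
  · rw [conj_eps, ← map_add]
    exact mul_mem (delta_mem i t _ _) (inv_mem (delta_mem i t _ _))
  · rw [conj_tau _ _ _ ht]
    exact inv_mem (delta_mem i t _ _)
  · rw [conj_mu _ _ _ _ ((map_ne_zero i).2 ha) ht, ← map_inv₀, ← map_mul, ← map_mul]
    exact delta_mem i t _ _

theorem inv_gen {K : Type*} [Field K] {F : Type*} [Field F] [Fintype F]
    (i : F →+* K) (t : K) (ht : t ≠ 0) (g : PGL2 K)
    (hg : g ∈ ({g | ∃ u : F, g = eps (i u)} ∪ {tau t} ∪
      {g | ∃ a : F, a ≠ 0 ∧ g = muA (i a)} : Set (PGL2 K))) :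
    g⁻¹ ∈ ({g | ∃ u : F, g = eps (i u)} ∪ {tau t} ∪
      {g | ∃ a : F, a ≠ 0 ∧ g = muA (i a)} : Set (PGL2 K)) := by
  rcases hg with (⟨w, rfl⟩ | rfl) | ⟨a, ha, rfl⟩
  · refine Or.inl (Or.inl ⟨-w, ?_⟩)
    apply inv_eq_of_mul_eq_one_left
    rw [← eps_add, ← map_add, neg_add_cancel, map_zero]
    exact pgl2_eq_one _ _ 1 (by simp [Matrix.one_fin_two])
  · exact Or.inl (Or.inr (inv_eq_of_mul_eq_one_left (tau_mul_self t ht)))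
  · refine Or.inr ⟨a⁻¹, inv_ne_zero ha, ?_⟩
    have ha' : i a ≠ 0 := (map_ne_zero i).2 ha
    apply inv_eq_of_mul_eq_one_left
    rw [map_inv₀]
    unfold muA
    rw [dif_neg ha', dif_neg (inv_ne_zero ha'), pgl2_mul]
    apply pgl2_eq_one _ _ 1
    simp [Matrix.mul_fin_two, Matrix.one_fin_two, ha']

/-- For `t ∈ K^*`, the Schottky group `Γ` is contained in `N` (the group generated by the
`ε_u`, `τ_t` and the `μ_a`) and is a normal subgroup of it: `gΓg⁻¹ = Γ` for every `g ∈ N`. -/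
theorem asm_gamma_normal_in_N
    {p m : ℕ} (hp : p.Prime) (hm : 0 < m) {q : ℕ} (hq : q = p ^ m)
    {K : Type*} [Field K] [CharP K p]
    {F : Type*} [Field F] [Fintype F] (hF : Fintype.card F = q) (i : F →+* K)
    (t : K) (ht : t ≠ 0) :
    GammaASM i t ≤ NASM i t ∧
      ∀ g ∈ NASM i t,
        (fun x => g * x * g⁻¹) '' (GammaASM i t : Set (PGL2 K)) =
          (GammaASM i t : Set (PGL2 K)) := by
  have mem_e : ∀ u : F, eps (i u) ∈ NASM i t := fun u =>
    Subgroup.subset_closure (Or.inl (Or.inl ⟨u, rfl⟩))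
  have mem_t : tau t ∈ NASM i t := Subgroup.subset_closure (Or.inl (Or.inr rfl))
  have mem_e' : ∀ u : F, eps' (i u) t ∈ NASM i t := fun u =>
    mul_mem (mul_mem mem_t (mem_e u)) mem_t
  have conj : ∀ g ∈ NASM i t, ∀ x ∈ GammaASM i t, g * x * g⁻¹ ∈ GammaASM i t := by
    intro g hg
    unfold NASM at hg
    induction hg using Subgroup.closure_induction'' with
    | one => intro x hx; simpa using hx
    | mem g hg => exact conj_N i t ht g hg
    | inv_mem g hg => exact conj_N i t ht _ (inv_gen i t ht g hg)
    | mul g h _ _ ihg ihh =>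
      intro x hx
      have := ihg _ (ihh x hx)
      simpa [mul_assoc] using this
  refine ⟨?_, fun g hg => ?_⟩
  · unfold GammaASM
    rw [Subgroup.closure_le]
    rintro x ⟨u, v, rfl⟩
    exact mul_mem (mul_mem (mul_mem (mem_e u) (mem_e' v)) (inv_mem (mem_e u)))
      (inv_mem (mem_e' v))
  · apply Set.Subset.antisymm
    · rintro _ ⟨x, hx, rfl⟩
      exact conj g hg x hx
    · intro x hx
      refine ⟨g⁻¹ * x * g, ?_, ?_⟩
      · simpa using conj g⁻¹ (inv_mem hg) x hx
      · change g * (g⁻¹ * x * g) * g⁻¹ = x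
        group
end

section
/- Let p be a prime, q = p^m, and let K be a field of characteristic p containing F_q, complete with respect to a nonarchimedean multiplicative norm |·|. Let t ∈ K with 0 < |t| < 1, and define in PGL(2,K): ε_u = class of [[1,u],[0,1]] for u ∈ F_q, τ_t = class of [[0,t],[1,0]], ε'_{u,t} = τ_t ε_u τ_t, δ_{u,v,t} = ε_u ε'_{v,t} ε_u^{−1} ε'_{v,t}^{−1}; let Γ be the subgroup generated by {δ_{u,v,t} : u,v ∈ F_q} and N₀ the subgroup generated by Γ ∪ {ε'_{u,t} : u ∈ F_q}. Then Γ is a normal subgroup of N₀ and the quotient group N₀/Γ is isomorphic to the additive group of F_q (an elementary abelian p-group of order q). -/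
open scoped Classical

open Matrix Polynomial in
/-- The map `SL(2,F[X]) → PGL(2,K)` induced by evaluating `X` at `s`. -/
noncomputable def asmPhi {K : Type*} [Field K] {F : Type*} [Field F] (i : F →+* K) (s : K) :
    Matrix.SpecialLinearGroup (Fin 2) F[X] →* PGL2 K :=
  (QuotientGroup.mk' _).comp
    (Matrix.SpecialLinearGroup.toGL.comp
      (Matrix.SpecialLinearGroup.map (Polynomial.eval₂RingHom i s)))

open Polynomial in
/-- Upper unipotent lift. -/
noncomputable def asmU {F : Type*} [Field F] (u : F) : Matrix.SpecialLinearGroup (Fin 2) F[X] :=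
  ⟨!![1, C u; 0, 1], by simp [Matrix.det_fin_two_of]⟩

open Polynomial in
/-- Lower unipotent lift. -/
noncomputable def asmL {F : Type*} [Field F] (v : F) : Matrix.SpecialLinearGroup (Fin 2) F[X] :=
  ⟨!![1, 0; C v * X, 1], by simp [Matrix.det_fin_two_of]⟩

open Polynomial in
theorem asmU_val {F : Type*} [Field F] (u : F) : (asmU u).1 = !![1, C u; 0, 1] := rfl

open Polynomial in
theorem asmL_val {F : Type*} [Field F] (v : F) : (asmL v).1 = !![1, 0; C v * X, 1] := rfl

open Polynomial in
theorem asmU_inv_val {F : Type*} [Field F] (u : F) : (asmU u)⁻¹.1 = !![1, -C u; 0, 1] := by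
  rw [Matrix.SpecialLinearGroup.coe_inv, asmU_val, Matrix.adjugate_fin_two_of, neg_zero]

open Polynomial in
theorem asmL_inv_val {F : Type*} [Field F] (v : F) :
    (asmL v)⁻¹.1 = !![1, 0; -(C v * X), 1] := by
  rw [Matrix.SpecialLinearGroup.coe_inv, asmL_val, Matrix.adjugate_fin_two_of, neg_zero]

theorem asm_mk_val {K : Type*} [Field K] (A : Matrix (Fin 2) (Fin 2) K) (h : A.det ≠ 0) :
    (Matrix.GeneralLinearGroup.mkOfDetNeZero A h).1 = A := rfl

open Polynomial in
theorem asm_map_val {K : Type*} [Field K] {F : Type*} [Field F] (f : F[X] →+* K)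
    (M : Matrix.SpecialLinearGroup (Fin 2) F[X]) :
    (Matrix.SpecialLinearGroup.toGL (Matrix.SpecialLinearGroup.map f M)).1 = M.1.map f := rfl

open Polynomial in
/-- The matrices congruent to upper unipotent modulo `X`, with lower left entry having
no linear term. -/
def asmS {F : Type*} [Field F] (M : Matrix.SpecialLinearGroup (Fin 2) F[X]) : Prop :=
  (M.1 0 0).coeff 0 = 1 ∧ (M.1 1 1).coeff 0 = 1 ∧ (M.1 1 0).coeff 0 = 0 ∧ (M.1 1 0).coeff 1 = 0

open Polynomial in
theorem asmS_one {F : Type*} [Field F] :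
    asmS (1 : Matrix.SpecialLinearGroup (Fin 2) F[X]) := by
  simp [asmS]

open Polynomial in
theorem asmS_inv {F : Type*} [Field F] {M : Matrix.SpecialLinearGroup (Fin 2) F[X]}
    (h : asmS M) : asmS M⁻¹ := by
  obtain ⟨h1, h2, h3, h4⟩ := h
  rw [Matrix.SpecialLinearGroup.SL2_inv_expl]
  refine ⟨?_, ?_, ?_, ?_⟩ <;> simp [h1, h2, h3, h4]

open Polynomial in
theorem asmS_mul {F : Type*} [Field F] {M N : Matrix.SpecialLinearGroup (Fin 2) F[X]}
    (h : asmS M) (h' : asmS N) : asmS (M * N) := by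
  obtain ⟨h1, h2, h3, h4⟩ := h
  obtain ⟨g1, g2, g3, g4⟩ := h'
  refine ⟨?_, ?_, ?_, ?_⟩ <;>
    simp only [Matrix.SpecialLinearGroup.coe_mul, Matrix.mul_apply, Fin.sum_univ_two, coeff_add,
      mul_coeff_zero, mul_coeff_one] <;>
    simp [h1, h2, h3, h4, g1, g2, g3, g4]

open Polynomial in
theorem asmS_comm {F : Type*} [Field F] (u v : F) :
    asmS (asmU u * asmL v * (asmU u)⁻¹ * (asmL v)⁻¹) := by
  refine ⟨?_, ?_, ?_, ?_⟩ <;>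
    simp only [Matrix.SpecialLinearGroup.coe_mul, asmU_inv_val, asmL_inv_val, asmU_val,
      asmL_val] <;>
    simp [mul_coeff_zero, mul_coeff_one]

theorem asmL_add {F : Type*} [Field F] (u v : F) : asmL (u + v) = asmL u * asmL v := by
  apply Subtype.ext
  rw [Matrix.SpecialLinearGroup.coe_mul, asmL_val, asmL_val, asmL_val]
  simp [add_mul]

theorem asmPhi_U {K : Type*} [Field K] {F : Type*} [Field F] (i : F →+* K) (s : K) (u : F) :
    asmPhi i s (asmU u) = eps (i u) := by
  unfold asmPhi eps pgl2
  simp only [MonoidHom.comp_apply, QuotientGroup.mk'_apply]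
  congr 1
  apply Units.ext
  rw [asm_map_val, asm_mk_val, asmU_val]
  ext a b
  fin_cases a <;> fin_cases b <;> simp

theorem asmPhi_L {K : Type*} [Field K] {F : Type*} [Field F] (i : F →+* K) (t : K) (ht : t ≠ 0)
    (v : F) : asmPhi i t⁻¹ (asmL v) = eps' (i v) t := by
  unfold asmPhi eps' eps tau pgl2
  simp only [MonoidHom.comp_apply, QuotientGroup.mk'_apply, ht, dite_false]
  rw [← QuotientGroup.mk_mul, ← QuotientGroup.mk_mul, QuotientGroup.eq,
    Matrix.GeneralLinearGroup.mem_center_iff_val_mem_range_scalar]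
  refine ⟨t, ?_⟩
  rw [Units.val_mul, ← Units.inv_mul_eq_iff_eq_mul, inv_inv]
  rw [asm_map_val, asmL_val, Units.val_mul, Units.val_mul, asm_mk_val, asm_mk_val]
  ext a b
  fin_cases a <;> fin_cases b <;>
    simp [Matrix.mul_apply, Fin.sum_univ_two, ht]

open Polynomial in
theorem asm_eval_inj {K : Type*} [NormedField K] {F : Type*} [Field F] [Fintype F]
    (i : F →+* K) (s : K) (hs0 : s ≠ 0) (hs : ‖s‖ ≠ 1) (f : F[X]) (hf : f.eval₂ i s = 0) :
    f = 0 := by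
  by_contra hne
  let : Algebra F K := i.toAlgebra
  have halg : IsAlgebraic F s := ⟨f, hne, hf⟩
  have : FiniteDimensional F (IntermediateField.adjoin F {s}) :=
    IntermediateField.adjoin.finiteDimensional halg.isIntegral
  have : Finite (IntermediateField.adjoin F {s}) := Module.finite_of_finite F
  let x : IntermediateField.adjoin F {s} := ⟨s, IntermediateField.mem_adjoin_simple_self F s⟩
  have hx : x ≠ 0 := fun h => hs0 (congrArg Subtype.val h)
  have hfo : IsOfFinOrder (Units.mk0 x hx) := isOfFinOrder_of_finite _
  obtain ⟨n, hn, h⟩ := isOfFinOrder_iff_pow_eq_one.1 hfo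
  have h2 : x ^ n = 1 := by simpa using congrArg Units.val h
  have h1 : s ^ n = 1 := by simpa [x] using congrArg Subtype.val h2
  apply hs
  have h3 : ‖s‖ ^ n = 1 := by rw [← norm_pow, h1, norm_one]
  exact (pow_eq_one_iff_of_nonneg (norm_nonneg _) hn.ne').1 h3

theorem asm_trivial_inter {K : Type*} [NormedField K] {F : Type*} [Field F] [Fintype F]
    (i : F →+* K) (t : K) (ht0 : 0 < ‖t‖) (ht1 : ‖t‖ < 1) (v : F)
    (h : eps' (i v) t ∈ GammaASM i t) : v = 0 := by
  have ht : t ≠ 0 := norm_pos_iff.1 ht0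
  have key : ∀ g ∈ GammaASM i t, ∃ M, asmS M ∧ asmPhi i t⁻¹ M = g := by
    intro g hg
    refine Subgroup.closure_induction (p := fun g _ => ∃ M, asmS M ∧ asmPhi i t⁻¹ M = g)
      ?_ ?_ ?_ ?_ hg
    · rintro _ ⟨u, v, rfl⟩
      refine ⟨_, asmS_comm u v, ?_⟩
      simp only [map_mul, map_inv, asmPhi_U, asmPhi_L i t ht, deltaC]
    · exact ⟨1, asmS_one, map_one _⟩
    · rintro _ _ _ _ ⟨M, hM, rfl⟩ ⟨N, hN, rfl⟩
      exact ⟨_, asmS_mul hM hN, map_mul _ _ _⟩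
    · rintro _ _ ⟨M, hM, rfl⟩
      exact ⟨_, asmS_inv hM, map_inv _ _⟩
  obtain ⟨M, hM, hMv⟩ := key _ h
  have h1 : asmPhi i t⁻¹ (M * (asmL v)⁻¹) = 1 := by
    rw [map_mul, map_inv, asmPhi_L i t ht, hMv, mul_inv_cancel]
  have h2 : ((M * (asmL v)⁻¹).1 1 0).eval₂ i t⁻¹ = 0 := by
    unfold asmPhi at h1
    rw [MonoidHom.comp_apply, QuotientGroup.mk'_apply, QuotientGroup.eq_one_iff,
      Matrix.GeneralLinearGroup.mem_center_iff_val_mem_range_scalar] at h1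
    obtain ⟨a, ha⟩ := h1
    rw [MonoidHom.comp_apply, asm_map_val] at ha
    have := congrFun (congrFun ha 1) 0
    rw [Matrix.map_apply] at this
    refine this.symm.trans ?_
    simp
  have h3 := asm_eval_inj i t⁻¹ (inv_ne_zero ht)
    (by rw [norm_inv]; exact fun h => ht1.ne (inv_eq_one.1 h)) _ h2
  rw [Matrix.SpecialLinearGroup.coe_mul, asmL_inv_val] at h3
  have h4 := congrArg (fun f => Polynomial.coeff f 1) h3
  obtain ⟨g1, g2, g3, g4⟩ := hM
  simpa [Matrix.mul_apply, Fin.sum_univ_two, Polynomial.mul_coeff_one, g1, g2, g3, g4]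
    using h4

theorem asm_conj {K : Type*} [Field K] {F : Type*} [Field F] [Fintype F]
    (i : F →+* K) (t : K) (hadd : ∀ u v : F, eps' (i (u + v)) t = eps' (i u) t * eps' (i v) t)
    (w : F) (g : PGL2 K) (hg : g ∈ GammaASM i t) :
    eps' (i w) t * g * (eps' (i w) t)⁻¹ ∈ GammaASM i t := by
  have : GammaASM i t ≤ (GammaASM i t).comap (MulAut.conj (eps' (i w) t)).toMonoidHom := by
    rw [GammaASM, Subgroup.closure_le]
    rintro _ ⟨u, v, rfl⟩
    have e : eps' (i w) t * deltaC (i u) (i v) t * (eps' (i w) t)⁻¹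
        = (deltaC (i u) (i w) t)⁻¹ * deltaC (i u) (i (w + v)) t := by
      simp only [deltaC, hadd]
      group
    have : eps' (i w) t * deltaC (i u) (i v) t * (eps' (i w) t)⁻¹ ∈ GammaASM i t := by
      rw [e]
      exact mul_mem (inv_mem (Subgroup.subset_closure ⟨u, w, rfl⟩))
        (Subgroup.subset_closure ⟨u, w + v, rfl⟩)
    exact this
  exact this hg

/-- For `0 < |t| < 1`, the Schottky group `Γ` is a normal subgroup of
`N₀ = ⟨Γ, E'⟩` and the quotient `N₀/Γ` is isomorphic to the additive group of `F_q`
(an elementary abelian `p`-group of order `q`). -/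
theorem asm_N0_quotient
    {p m : ℕ} (hp : p.Prime) (hm : 0 < m) {q : ℕ} (hq : q = p ^ m)
    {K : Type*} [NormedField K] [CompleteSpace K] [IsUltrametricDist K] [CharP K p]
    {F : Type*} [Field F] [Fintype F] (hF : Fintype.card F = q) (i : F →+* K)
    (t : K) (ht0 : 0 < ‖t‖) (ht1 : ‖t‖ < 1) :
    ((GammaASM i t).subgroupOf (N0ASM i t)).Normal ∧
      ∃ φ : N0ASM i t →* Multiplicative F,
        Function.Surjective φ ∧ φ.ker = (GammaASM i t).subgroupOf (N0ASM i t) := by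
  have ht : t ≠ 0 := norm_pos_iff.1 ht0
  have hadd : ∀ u v : F, eps' (i (u + v)) t = eps' (i u) t * eps' (i v) t := by
    intro u v
    simp only [← asmPhi_L i t ht, asmL_add, map_mul]
  have hzero : eps' (i 0) t = 1 := by
    have := hadd 0 0
    rw [add_zero] at this
    exact left_eq_mul.1 this
  have hneg : ∀ v : F, eps' (i (-v)) t = (eps' (i v) t)⁻¹ := by
    intro v
    rw [eq_inv_iff_mul_eq_one, ← hadd, neg_add_cancel, hzero]
  have hle : GammaASM i t ≤ N0ASM i t := le_sup_left
  have hmem : ∀ v : F, eps' (i v) t ∈ N0ASM i t := fun v =>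
    (le_sup_right : _ ≤ N0ASM i t) (Subgroup.subset_closure ⟨v, rfl⟩)
  have hnormal : ((GammaASM i t).subgroupOf (N0ASM i t)).Normal := by
    rw [Subgroup.normal_subgroupOf_iff_le_normalizer hle]
    refine sup_le Subgroup.le_normalizer ?_
    rw [Subgroup.closure_le]
    rintro _ ⟨w, rfl⟩
    refine Subgroup.mem_normalizer_iff.2 fun g => ⟨asm_conj i t hadd w g, fun h => ?_⟩
    have := asm_conj i t hadd (-w) _ h
    rw [hneg] at this
    simpa [mul_assoc] using this
  refine ⟨hnormal, ?_⟩
  let e : Multiplicative F →* N0ASM i t :=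
    { toFun := fun v => ⟨eps' (i v.toAdd) t, hmem _⟩
      map_one' := Subtype.ext hzero
      map_mul' := fun u v => Subtype.ext (hadd _ _) }
  let π := QuotientGroup.mk' ((GammaASM i t).subgroupOf (N0ASM i t))
  have hinj : Function.Injective (π.comp e) := by
    rw [injective_iff_map_eq_one]
    intro v hv
    have h1 : e v ∈ (GammaASM i t).subgroupOf (N0ASM i t) :=
      (QuotientGroup.eq_one_iff _).1 hv
    exact asm_trivial_inter i t ht0 ht1 v.toAdd (Subgroup.mem_subgroupOf.1 h1)
  have hsurj : Function.Surjective (π.comp e) := by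
    have hR : N0ASM i t ≤ (((π.comp e).range).comap π).map (N0ASM i t).subtype := by
      refine sup_le ?_ ?_
      · intro g hg
        refine ⟨⟨g, hle hg⟩, ⟨1, ?_⟩, rfl⟩
        rw [map_one]
        exact ((QuotientGroup.eq_one_iff _).2 (Subgroup.mem_subgroupOf.2 hg)).symm
      · rw [Subgroup.closure_le]
        rintro _ ⟨v, rfl⟩
        exact ⟨⟨_, hmem v⟩, ⟨Multiplicative.ofAdd v, rfl⟩, rfl⟩
    intro x
    obtain ⟨g, rfl⟩ := QuotientGroup.mk'_surjective _ x
    obtain ⟨g', hg', hgg⟩ := hR g.2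
    obtain rfl : g' = g := Subtype.ext hgg
    exact hg'
  let E := MulEquiv.ofBijective (π.comp e) ⟨hinj, hsurj⟩
  refine ⟨E.symm.toMonoidHom.comp π,
    E.symm.surjective.comp (QuotientGroup.mk'_surjective _), ?_⟩
  ext g
  rw [MonoidHom.mem_ker, MonoidHom.comp_apply, ← QuotientGroup.eq_one_iff]
  exact map_eq_one_iff E.symm E.symm.injective
end
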